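/- arXiv:2303.00322 — 9 statements merged into one kernel-verified Lean document; each statement's English description precedes it below -/
import Mathlib

section
/- Let (G, D, ⋄, I) be a partial semigroup with identity and S a complete idempotent semiring. The convolution operation ⋆ on functions G → S is associative: for all λ₀, λ₁, λ₂ : G → S, λ₀ ⋆ (λ₁ ⋆ λ₂) = (λ₀ ⋆ λ₁) ⋆ λ₂. -/
/-- A partial semigroup with identity: a binary domain relation `D`,
a partial operation `op`, and a set `I` of identity elements,
satisfying axioms (i)-(vi). -/
structure PartialSemigroupWithIdentity (G : Type*) where
  D : G → G → Prop
  op : G → G → G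
  I : Set G
  ax_i : ∀ x y z, (D x y ∧ D (op x y) z) ↔ (D y z ∧ D x (op y z))
  ax_ii : ∀ x y z, D x y → D (op x y) z → op (op x y) z = op x (op y z)
  ax_iii : ∀ x, ∃ y ∈ I, D x y
  ax_iv : ∀ x, ∃ y ∈ I, D y x
  ax_v : ∀ x y, D x y → y ∈ I → x = op x y
  ax_vi : ∀ x y, D y x → y ∈ I → x = op y x

variable {G S : Type*}

/-- Convolution of `S`-valued functions on `G`:
`(f ⋆ g)(x) = ⨆ { f y · g z | D y z and y ⋄ z = x }`. -/
noncomputable def conv [CompleteLattice S] [Monoid S]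
    (P : PartialSemigroupWithIdentity G) (f g : G → S) : G → S :=
  fun x => ⨆ p : {p : G × G // P.D p.1 p.2 ∧ P.op p.1 p.2 = x}, f p.val.1 * g p.val.2

open Classical in
/-- The convolution unit: `1` on `I` and `⊥` elsewhere. -/
noncomputable def cunit [CompleteLattice S] [Monoid S]
    (P : PartialSemigroupWithIdentity G) : G → S :=
  fun x => if x ∈ P.I then 1 else ⊥

theorem mul_le_conv [CompleteLattice S] [Monoid S] (P : PartialSemigroupWithIdentity G)
    (f g : G → S) {y z : G} (h : P.D y z) : f y * g z ≤ conv P f g (P.op y z) :=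
  le_iSup (fun p : {p : G × G // P.D p.1 p.2 ∧ P.op p.1 p.2 = P.op y z} =>
    f p.val.1 * g p.val.2) ⟨(y, z), h, rfl⟩

/-- Convolution is associative. -/
theorem stmt_4 [Nonempty G] [CompleteLattice S] [Monoid S]
    (hl : ∀ (x : S) (A : Set S), x * sSup A = ⨆ a ∈ A, x * a)
    (hr : ∀ (x : S) (A : Set S), sSup A * x = ⨆ a ∈ A, a * x)
    (P : PartialSemigroupWithIdentity G) (l₀ l₁ l₂ : G → S) :
    conv P l₀ (conv P l₁ l₂) = conv P (conv P l₀ l₁) l₂ := by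
  have : IsQuantale S := ⟨hl, fun A x => hr x A⟩
  funext x
  apply le_antisymm
  · refine iSup_le ?_
    rintro ⟨⟨y, w⟩, hyw, rfl⟩
    dsimp only at hyw ⊢
    rw [show conv P l₁ l₂ w = ⨆ p : {p : G × G // P.D p.1 p.2 ∧ P.op p.1 p.2 = w},
      l₁ p.val.1 * l₂ p.val.2 from rfl, Quantale.mul_iSup_distrib]
    refine iSup_le ?_
    rintro ⟨⟨z, u⟩, hzu, rfl⟩
    obtain ⟨hyz, hyzu⟩ := (P.ax_i y z u).2 ⟨hzu, hyw⟩
    rw [← mul_assoc, ← P.ax_ii y z u hyz hyzu]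
    exact (mul_le_mul_left (mul_le_conv P l₀ l₁ hyz) _).trans (mul_le_conv P _ l₂ hyzu)
  · refine iSup_le ?_
    rintro ⟨⟨w, u⟩, hwu, rfl⟩
    dsimp only at hwu ⊢
    rw [show conv P l₀ l₁ w = ⨆ p : {p : G × G // P.D p.1 p.2 ∧ P.op p.1 p.2 = w},
      l₀ p.val.1 * l₁ p.val.2 from rfl, Quantale.iSup_mul_distrib]
    refine iSup_le ?_
    rintro ⟨⟨y, z⟩, hyz, rfl⟩
    obtain ⟨hzu, hyzu⟩ := (P.ax_i y z u).1 ⟨hyz, hwu⟩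
    rw [mul_assoc, P.ax_ii y z u hyz hwu]
    exact (mul_le_mul_right (mul_le_conv P l₁ l₂ hzu) _).trans (mul_le_conv P l₀ _ hyzu)
end

section
/- Let (G, D, ⋄, I) be a partial semigroup with identity and S a complete idempotent semiring. The function e (equal to 1 on I and ⊥ elsewhere) is a two-sided identity for convolution: for every λ : G → S, λ ⋆ e = λ and e ⋆ λ = λ. -/
variable {G S : Type*}

/-- An indexed supremum whose terms are all equal to `⊥` or `a`, with `a` attained, is `a`. -/
theorem iSup_eq_of_forall_eq_bot_or_eq [CompleteLattice S] {ι : Sort*} {f : ι → S} {a : S}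
    (h : ∀ i, f i = ⊥ ∨ f i = a) (i : ι) (hi : f i = a) : ⨆ i, f i = a := by
  refine le_antisymm (iSup_le fun j => ?_) (hi ▸ le_iSup f i)
  rcases h j with hj | hj <;> simp [hj]

/-- The function `cunit P` (equal to `1` on `I` and `⊥` elsewhere) is a
two-sided identity for convolution. -/
theorem stmt_5 [Nonempty G] [CompleteLattice S] [Monoid S]
    (hl : ∀ (x : S) (A : Set S), x * sSup A = ⨆ a ∈ A, x * a)
    (hr : ∀ (x : S) (A : Set S), sSup A * x = ⨆ a ∈ A, a * x)
    (P : PartialSemigroupWithIdentity G) (l : G → S) :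
    conv P l (cunit P) = l ∧ conv P (cunit P) l = l := by
  have mul_bot : ∀ x : S, x * ⊥ = ⊥ := fun x => by simpa using hl x ∅
  have bot_mul : ∀ x : S, ⊥ * x = ⊥ := fun x => by simpa using hr x ∅
  constructor
  · funext x
    obtain ⟨y, hy, hxy⟩ := P.ax_iii x
    refine iSup_eq_of_forall_eq_bot_or_eq ?_ ⟨(x, y), hxy, (P.ax_v x y hxy hy).symm⟩ ?_
    · rintro ⟨⟨a, b⟩, hab, rfl⟩
      by_cases hb : b ∈ P.I
      · simp [cunit, hb, ← P.ax_v a b hab hb]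
      · simp [cunit, hb, mul_bot]
    · simp [cunit, hy]
  · funext x
    obtain ⟨y, hy, hyx⟩ := P.ax_iv x
    refine iSup_eq_of_forall_eq_bot_or_eq ?_ ⟨(y, x), hyx, (P.ax_vi x y hyx hy).symm⟩ ?_
    · rintro ⟨⟨a, b⟩, hab, rfl⟩
      by_cases ha : a ∈ P.I
      · simp [cunit, ha, ← P.ax_vi b a hab ha]
      · simp [cunit, ha, bot_mul]
    · simp [cunit, hy]
end

section
/- Let (G, D, ⋄, I) be a partial semigroup with identity and S a complete idempotent semiring. The star operation on G → S is *-continuous: for all δ, λ, θ : G → S, δ ⋆ λ* ⋆ θ = ⨆ n, δ ⋆ λⁿ ⋆ θ (pointwise supremum over n ∈ ℕ). -/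
variable {G S : Type*}

/-- Convolution powers: `λ⁰ = cunit P`, `λ^(n+1) = λⁿ ⋆ λ`. -/
noncomputable def cpow [CompleteLattice S] [Monoid S]
    (P : PartialSemigroupWithIdentity G) (f : G → S) : ℕ → (G → S)
  | 0 => cunit P
  | n + 1 => conv P (cpow P f n) f

/-- The Kleene star of a function: the pointwise supremum of its powers. -/
noncomputable def cstar [CompleteLattice S] [Monoid S]
    (P : PartialSemigroupWithIdentity G) (f : G → S) : G → S :=
  ⨆ n : ℕ, cpow P f n

theorem conv_iSup_right [CompleteLattice S] [Monoid S]
    (hl : ∀ (x : S) (A : Set S), x * sSup A = ⨆ a ∈ A, x * a)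
    (P : PartialSemigroupWithIdentity G) {ι : Sort*} (f : G → S) (g : ι → G → S) :
    conv P f (⨆ i, g i) = ⨆ i, conv P f (g i) := by
  funext x
  simp only [conv, iSup_apply]
  rw [iSup_comm]
  refine iSup_congr fun p => ?_
  rw [iSup, hl, iSup_range]

theorem conv_iSup_left [CompleteLattice S] [Monoid S]
    (hr : ∀ (x : S) (A : Set S), sSup A * x = ⨆ a ∈ A, a * x)
    (P : PartialSemigroupWithIdentity G) {ι : Sort*} (f : ι → G → S) (g : G → S) :
    conv P (⨆ i, f i) g = ⨆ i, conv P (f i) g := by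
  funext x
  simp only [conv, iSup_apply]
  rw [iSup_comm]
  refine iSup_congr fun p => ?_
  rw [iSup, hr, iSup_range]

/-- The star operation is `*`-continuous: `δ ⋆ λ* ⋆ θ = ⨆ n, δ ⋆ λⁿ ⋆ θ`. -/
theorem stmt_8 [Nonempty G] [CompleteLattice S] [Monoid S]
    (hl : ∀ (x : S) (A : Set S), x * sSup A = ⨆ a ∈ A, x * a)
    (hr : ∀ (x : S) (A : Set S), sSup A * x = ⨆ a ∈ A, a * x)
    (P : PartialSemigroupWithIdentity G) (δ l θ : G → S) :
    conv P (conv P δ (cstar P l)) θ = ⨆ n : ℕ, conv P (conv P δ (cpow P l n)) θ := by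
  rw [cstar, conv_iSup_right hl, conv_iSup_left hr]
end

section
/- Let (G, D, ⋄, I) be a partial semigroup with identity and S a complete idempotent semiring. If λ, λ' ∈ W, then λ ⋆ λ' ∈ W, and moreover (λ ⋆ λ')(x) = λ x · λ' x for every x ∈ I. -/
variable {G S : Type*}

/-- The set `W` of weights: functions that are `⊥` outside `I` and constant on `I`. -/
def Wset [CompleteLattice S] [Monoid S]
    (P : PartialSemigroupWithIdentity G) : Set (G → S) :=
  {f | (∀ x ∉ P.I, f x = ⊥) ∧ ∀ x ∈ P.I, ∀ y ∈ P.I, f x = f y}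

namespace PartialSemigroupWithIdentity

variable (P : PartialSemigroupWithIdentity G)

/-- Composable identities coincide. -/
lemma eq_of_D_of_mem_I {x y : G} (hD : P.D x y) (hx : x ∈ P.I) (hy : y ∈ P.I) : x = y :=
  (P.ax_v x y hD hy).trans (P.ax_vi y x hD hx).symm

lemma D_self_of_mem_I {x : G} (hx : x ∈ P.I) : P.D x x := by
  obtain ⟨y, hy, hD⟩ := P.ax_iii x
  rwa [← P.eq_of_D_of_mem_I hD hx hy] at hD

lemma op_self_of_mem_I {x : G} (hx : x ∈ P.I) : P.op x x = x :=
  (P.ax_v x x (P.D_self_of_mem_I hx) hx).symm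

end PartialSemigroupWithIdentity

/-- The convolution of functions vanishing outside `I` vanishes outside `I`. -/
lemma conv_eq_bot_of_notMem_I [CompleteLattice S] [Monoid S]
    (mul_bot : ∀ a : S, a * ⊥ = ⊥) (bot_mul : ∀ a : S, ⊥ * a = ⊥)
    (P : PartialSemigroupWithIdentity G) {f g : G → S}
    (hf : ∀ x ∉ P.I, f x = ⊥) (hg : ∀ x ∉ P.I, g x = ⊥) {x : G} (hx : x ∉ P.I) :
    conv P f g x = ⊥ := by
  refine iSup_eq_bot.2 ?_
  rintro ⟨⟨y, z⟩, hD, rfl⟩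
  by_cases hz : z ∈ P.I
  · rw [← P.ax_v y z hD hz] at hx
    simp only [hf y hx, bot_mul]
  · simp only [hg z hz, mul_bot]

/-- On `I`, the convolution of functions vanishing outside `I` is the pointwise product. -/
lemma conv_eq_mul_of_mem_I [CompleteLattice S] [Monoid S]
    (mul_bot : ∀ a : S, a * ⊥ = ⊥) (bot_mul : ∀ a : S, ⊥ * a = ⊥)
    (P : PartialSemigroupWithIdentity G) {f g : G → S}
    (hf : ∀ x ∉ P.I, f x = ⊥) (hg : ∀ x ∉ P.I, g x = ⊥) {x : G} (hx : x ∈ P.I) :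
    conv P f g x = f x * g x := by
  apply le_antisymm
  · refine iSup_le ?_
    rintro ⟨⟨y, z⟩, hD, rfl⟩
    by_cases hy : y ∈ P.I
    · by_cases hz : z ∈ P.I
      · obtain rfl : y = z := P.eq_of_D_of_mem_I hD hy hz
        simp only [P.op_self_of_mem_I hy, le_refl]
      · simp only [hg z hz, mul_bot, bot_le]
    · simp only [hf y hy, bot_mul, bot_le]
  · exact le_iSup_of_le ⟨(x, x), P.D_self_of_mem_I hx, P.op_self_of_mem_I hx⟩ le_rfl

/-- `W` is closed under convolution, and on `I` convolution of weights is
computed pointwise by semiring multiplication. -/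
theorem stmt_10 [Nonempty G] [CompleteLattice S] [Monoid S]
    (hl : ∀ (x : S) (A : Set S), x * sSup A = ⨆ a ∈ A, x * a)
    (hr : ∀ (x : S) (A : Set S), sSup A * x = ⨆ a ∈ A, a * x)
    (P : PartialSemigroupWithIdentity G) (l l' : G → S)
    (hla : l ∈ Wset P) (hlb : l' ∈ Wset P) :
    conv P l l' ∈ Wset P ∧ ∀ x ∈ P.I, conv P l l' x = l x * l' x := by
  have mul_bot (a : S) : a * ⊥ = ⊥ := by simpa using hl a ∅
  have bot_mul (a : S) : ⊥ * a = ⊥ := by simpa using hr a ∅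
  have hmul : ∀ x ∈ P.I, conv P l l' x = l x * l' x := fun x hx =>
    conv_eq_mul_of_mem_I mul_bot bot_mul P hla.1 hlb.1 hx
  refine ⟨⟨fun x hx => conv_eq_bot_of_notMem_I mul_bot bot_mul P hla.1 hlb.1 hx,
    fun x hx y hy => ?_⟩, hmul⟩
  rw [hmul x hx, hmul y hy, hla.2 x hx y hy, hlb.2 x hx y hy]
end

section
/- Let (G, D, ⋄, I) be a partial semigroup with identity and S a complete idempotent semiring, and fix i ∈ I (I is nonempty by axiom (iii)). The evaluation map φ : W → S defined by φ(λ) = λ i is a bijection from W onto S satisfying φ(e) = 1, φ(0) = ⊥, φ(λ ⊔ μ) = φ(λ) ⊔ φ(μ), and φ(λ ⋆ μ) = φ(λ) · φ(μ) for all λ, μ ∈ W. Hence (W, ⋆, ⊔, e, 0) is a semiring isomorphic to S. -/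
variable {G S : Type*}

/-- Evaluation at a fixed identity element `i ∈ I` is a bijection from `W` onto `S`
that maps the convolution unit to `1`, the zero function to `⊥`, pointwise joins to
joins, and convolutions to products; hence `(W, ⋆, ⊔, cunit, ⊥)` is a semiring
isomorphic to `S`. -/
theorem stmt_11 [Nonempty G] [CompleteLattice S] [Monoid S]
    (hl : ∀ (x : S) (A : Set S), x * sSup A = ⨆ a ∈ A, x * a)
    (hr : ∀ (x : S) (A : Set S), sSup A * x = ⨆ a ∈ A, a * x)
    (P : PartialSemigroupWithIdentity G) (i : G) (hi : i ∈ P.I) :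
    Set.BijOn (fun f : G → S => f i) (Wset P) Set.univ ∧
    cunit P i = (1 : S) ∧
    (⊥ : G → S) i = (⊥ : S) ∧
    (∀ l m : G → S, l ∈ Wset P → m ∈ Wset P → (l ⊔ m) i = l i ⊔ m i) ∧
    (∀ l m : G → S, l ∈ Wset P → m ∈ Wset P → conv P l m i = l i * m i) := by
  classical
  have mul_bot' (x : S) : x * ⊥ = ⊥ := by simpa using hl x ∅
  have bot_mul' (x : S) : ⊥ * x = ⊥ := by simpa using hr x ∅
  refine ⟨⟨fun _ _ => Set.mem_univ _, ?_, ?_⟩, by simp [cunit, hi], rfl, fun _ _ _ _ => rfl, ?_⟩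
  · intro f hf g hg h
    funext x
    by_cases hx : x ∈ P.I
    · rw [hf.2 x hx i hi, hg.2 x hx i hi]
      exact h
    · rw [hf.1 x hx, hg.1 x hx]
  · intro s _
    refine ⟨fun x => if x ∈ P.I then s else ⊥, ⟨?_, ?_⟩, by simp [hi]⟩
    · intro x hx
      simp [hx]
    · intro x hx y hy
      simp [hx, hy]
  · intro l m hlW hmW
    apply le_antisymm
    · refine iSup_le ?_
      rintro ⟨⟨y, z⟩, _, _⟩
      by_cases hy : y ∈ P.I
      · by_cases hz : z ∈ P.I
        · exact (congrArg₂ (· * ·) (hlW.2 y hy i hi) (hmW.2 z hz i hi)).le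
        · simp [hmW.1 z hz, mul_bot']
      · simp [hlW.1 y hy, bot_mul']
    · obtain ⟨y, hy, hD⟩ := P.ax_iii i
      rw [hmW.2 i hi y hy]
      exact le_iSup
        (fun p : {p : G × G // P.D p.1 p.2 ∧ P.op p.1 p.2 = i} => l p.val.1 * m p.val.2)
        ⟨(i, y), hD, (P.ax_v i y hD hy).symm⟩
end

section
/- For all λ, λ' : GS → ℕ∞, τ(λ · λ') = (τ(λ) ⋄ τ(λ'))^⋓, where on the left · is the min-plus convolution of functions and on the right ⋄ is the coalesced product of sets of weighted guarded strings followed by the unambiguous-minimization operation ^⋓. That is, τ turns min-plus convolution into the product of the algebra of weighted guarded languages. -/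
/-- An atom over the Boolean variables `A` is a truth-value assignment `A → Bool`. -/
abbrev Atom (A : Type*) := A → Bool

/-- A guarded string over `A, T`: a first atom together with a list of
(program variable, atom) pairs. -/
abbrev GS (A T : Type*) := Atom A × List (T × Atom A)

/-- The first atom of a guarded string. -/
def firstAtom {A T : Type*} (s : GS A T) : Atom A := s.1

/-- The last atom of a guarded string. -/
def lastAtom {A T : Type*} (s : GS A T) : Atom A :=
  (s.2.getLast?.map Prod.snd).getD s.1

/-- The domain relation for the coalesced product. -/
def gsD {A T : Type*} (s t : GS A T) : Prop := lastAtom s = firstAtom t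

/-- The coalesced product of guarded strings. -/
def gsOp {A T : Type*} (s t : GS A T) : GS A T := (s.1, s.2 ++ t.2)

/-- `τ` sends `λ : GS → ℕ∞` to its set of weighted guarded strings
`{(s, n) | λ s = n}`. -/
def tau {A T : Type*} (l : GS A T → ℕ∞) : Set (GS A T × ℕ) :=
  {p | l p.1 = (p.2 : ℕ∞)}

/-- A set of weighted guarded strings is unambiguous if each guarded string
occurs with at most one weight. -/
def Unamb {A T : Type*} (X : Set (GS A T × ℕ)) : Prop :=
  ∀ (s : GS A T) (n m : ℕ), (s, n) ∈ X → (s, m) ∈ X → n = m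

/-- Unambiguous minimization `X^⋓`: keep, for each guarded string, only the
least weight with which it occurs in `X`. -/
def minim {A T : Type*} (X : Set (GS A T × ℕ)) : Set (GS A T × ℕ) :=
  {p | IsLeast {m | (p.1, m) ∈ X} p.2}

/-- Min-plus convolution of `ℕ∞`-valued functions on guarded strings:
`(λ · λ')(s) = ⨅ { λ t + λ' u | gsD t u and t ⋄ u = s }` (infimum in `ℕ∞`,
the infimum of the empty set being `⊤ = ∞`). -/
noncomputable def mconv {A T : Type*} (l l' : GS A T → ℕ∞) : GS A T → ℕ∞ :=
  fun s => ⨅ p : {p : GS A T × GS A T // gsD p.1 p.2 ∧ gsOp p.1 p.2 = s},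
    l p.val.1 + l' p.val.2

/-- The coalesced product of weighted guarded strings,
`(s, n) ⋄ (t, m) = (s ⋄ t, n + m)` when `gsD s t`, lifted to sets. -/
def wProd {A T : Type*} (X Y : Set (GS A T × ℕ)) : Set (GS A T × ℕ) :=
  {p | ∃ x ∈ X, ∃ y ∈ Y, gsD x.1 y.1 ∧ p = (gsOp x.1 y.1, x.2 + y.2)}

/-- An `ℕ∞`-valued infimum equals a natural number iff that number is the least
finite value of the family. -/
theorem iInf_eq_natCast_iff_isLeast {ι : Sort*} (f : ι → ℕ∞) (n : ℕ) :
    ⨅ i, f i = (n : ℕ∞) ↔ IsLeast {m : ℕ | ∃ i, f i = (m : ℕ∞)} n := by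
  constructor
  · intro h
    refine ⟨?_, ?_⟩
    · rcases isEmpty_or_nonempty ι with _ | _
      · exact absurd (h.symm.trans (iInf_of_empty f)) (ENat.natCast_ne_top n)
      · obtain ⟨i, hi⟩ := ciInf_mem f
        exact ⟨i, hi.trans h⟩
    · rintro m ⟨i, hi⟩
      exact_mod_cast h ▸ hi ▸ iInf_le f i
  · rintro ⟨⟨i, hi⟩, hn⟩
    refine le_antisymm (hi ▸ iInf_le f i) (le_iInf fun j => ?_)
    cases hj : f j using ENat.recTopCoe with
    | top => exact le_top
    | coe m => exact_mod_cast hn ⟨j, hj⟩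

/-- The weights of `s` in the product of two weighted languages are the finite
sums occurring in the min-plus convolution at `s`. -/
theorem mem_wProd_tau_iff {A T : Type*} (l l' : GS A T → ℕ∞) (s : GS A T) (m : ℕ) :
    (s, m) ∈ wProd (tau l) (tau l') ↔
      ∃ p : {p : GS A T × GS A T // gsD p.1 p.2 ∧ gsOp p.1 p.2 = s},
        l p.val.1 + l' p.val.2 = (m : ℕ∞) := by
  constructor
  · rintro ⟨⟨t, a⟩, ht, ⟨u, b⟩, hu, hD, he⟩
    obtain ⟨rfl, rfl⟩ := Prod.mk.inj he
    refine ⟨⟨(t, u), hD, rfl⟩, ?_⟩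
    have ht' : l t = a := ht
    have hu' : l' u = b := hu
    simp [ht', hu']
  · rintro ⟨⟨⟨t, u⟩, hD, rfl⟩, h⟩
    have h' : l t + l' u = (m : ℕ∞) := h
    have hfin : l t + l' u ≠ ⊤ := h' ▸ ENat.natCast_ne_top m
    obtain ⟨ht, hu⟩ := WithTop.add_ne_top.1 hfin
    obtain ⟨a, ha⟩ := ENat.ne_top_iff_exists.1 ht
    obtain ⟨b, hb⟩ := ENat.ne_top_iff_exists.1 hu
    have hab : a + b = m := by
      rw [← ha, ← hb] at h'
      exact_mod_cast h'
    exact ⟨(t, a), ha.symm, (u, b), hb.symm, hD, by rw [← hab]⟩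

/-- `τ` turns min-plus convolution into the product (coalesced product followed
by unambiguous minimization) of the algebra of weighted guarded languages. -/
theorem stmt_14 (A T : Type*) [Fintype A] [Nonempty A] (l l' : GS A T → ℕ∞) :
    tau (mconv l l') = minim (wProd (tau l) (tau l')) := by
  ext ⟨s, n⟩
  simp only [minim, Set.mem_ofPred_eq, mem_wProd_tau_iff]
  exact iInf_eq_natCast_iff_isLeast _ n
end

section
/- For all λ, λ' : GS → ℕ∞, τ(λ + λ') = τ(λ) ⋓ τ(λ'), where on the left (λ + λ')(s) = min(λ s, λ' s) is the pointwise minimum and on the right ⋓ is the unambiguous union of sets of weighted guarded strings. -/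
/-- Unambiguous union of sets of weighted guarded strings. -/
def uunion {A T : Type*} (X Y : Set (GS A T × ℕ)) : Set (GS A T × ℕ) :=
  minim (X ∪ Y)

/-- `τ` turns pointwise minimum into unambiguous union. -/
theorem stmt_15 (A T : Type*) [Fintype A] [Nonempty A] (l l' : GS A T → ℕ∞) :
    tau (fun s => min (l s) (l' s)) = uunion (tau l) (tau l') := by
  ext ⟨s, n⟩
  simp only [tau, uunion, minim, IsLeast, lowerBounds, Set.mem_union, Set.mem_ofPred_eq]
  constructor
  · intro h
    refine ⟨?_, ?_⟩
    · rcases min_choice (l s) (l' s) with hm | hm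
      · exact Or.inl (hm.symm.trans h)
      · exact Or.inr (hm.symm.trans h)
    · rintro m (hm | hm)
      · exact_mod_cast h.symm.le.trans ((min_le_left _ _).trans hm.le)
      · exact_mod_cast h.symm.le.trans ((min_le_right _ _).trans hm.le)
  · rintro ⟨h, hle⟩
    have le_of_weight {x : ℕ∞} (hx : ∀ m : ℕ, x = m → n ≤ m) : (n : ℕ∞) ≤ x := by
      induction x using ENat.recTopCoe with
      | top => exact le_top
      | coe m => exact_mod_cast hx m rfl
    refine le_antisymm ?_ (le_min (le_of_weight fun m hm => hle (Or.inl hm))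
      (le_of_weight fun m hm => hle (Or.inr hm)))
    rcases h with h | h
    · exact (min_le_left _ _).trans h.le
    · exact (min_le_right _ _).trans h.le
end

section
/- For every λ : GS → ℕ∞, τ(λ*) = (⋃ n, τ(λ)ⁿ)^⋓, where λ*(s) = ⨅ n, λⁿ(s) is the min-plus Kleene star of functions and τ(λ)ⁿ are the powers of the set τ(λ) in the algebra of weighted guarded languages (with X⁰ = {(A, 0) | A ∈ 1_A} and X^(n+1) = (Xⁿ ⋄ X)^⋓). -/
open Classical in
/-- The min-plus convolution unit: `0` on atoms (guarded strings with empty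
list) and `∞` elsewhere. -/
noncomputable def munit {A T : Type*} : GS A T → ℕ∞ :=
  fun s => if s.2 = [] then 0 else ⊤

/-- Min-plus powers: `λ⁰ = munit`, `λ^(n+1) = λⁿ · λ`. -/
noncomputable def mpow {A T : Type*} (l : GS A T → ℕ∞) : ℕ → GS A T → ℕ∞
  | 0 => munit
  | n + 1 => mconv (mpow l n) l

/-- The min-plus Kleene star: `λ*(s) = ⨅ n, λⁿ(s)`. -/
noncomputable def mstar {A T : Type*} (l : GS A T → ℕ∞) : GS A T → ℕ∞ :=
  fun s => ⨅ n : ℕ, mpow l n s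

/-- Powers of a set of weighted guarded strings in the algebra of weighted
guarded languages: `X⁰ = {(A, 0) | A an atom}`, `X^(n+1) = (Xⁿ ⋄ X)^⋓`. -/
def wpow {A T : Type*} (X : Set (GS A T × ℕ)) : ℕ → Set (GS A T × ℕ)
  | 0 => {p | p.1.2 = [] ∧ p.2 = 0}
  | n + 1 => minim (wProd (wpow X n) X)

theorem tau_mconv {A T : Type*} (l l' : GS A T → ℕ∞) :
    tau (mconv l l') = minim (wProd (tau l) (tau l')) := by
  ext ⟨s, n⟩
  refine (iInf_eq_natCast_iff_isLeast _ n).trans ?_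
  suffices h : {m : ℕ | ∃ p : {p : GS A T × GS A T // gsD p.1 p.2 ∧ gsOp p.1 p.2 = s},
      l p.val.1 + l' p.val.2 = (m : ℕ∞)} = {m | (s, m) ∈ wProd (tau l) (tau l')} by
    rw [h]
    rfl
  ext m
  constructor
  · rintro ⟨⟨⟨t, u⟩, hD, rfl⟩, hm⟩
    obtain ⟨a, b, ha, hb, rfl⟩ := WithTop.add_eq_coe.mp hm
    exact ⟨(t, a), ha.symm, (u, b), hb.symm, hD, rfl⟩
  · rintro ⟨⟨t, a⟩, ha, ⟨u, b⟩, hb, hD, heq⟩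
    obtain ⟨rfl, rfl⟩ := Prod.mk.inj heq
    refine ⟨⟨(t, u), hD, rfl⟩, ?_⟩
    rw [show l t = a from ha, show l' u = b from hb, Nat.cast_add]

theorem tau_mpow {A T : Type*} (l : GS A T → ℕ∞) (n : ℕ) :
    tau (mpow l n) = wpow (tau l) n := by
  induction n with
  | zero =>
    ext ⟨s, m⟩
    by_cases hs : s.2 = [] <;> simp [tau, mpow, wpow, munit, hs, eq_comm]
  | succ n ih => rw [mpow, tau_mconv, ih, wpow]

/-- `τ` turns the min-plus Kleene star into the star of the algebra of weighted
guarded languages. -/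
theorem stmt_16 (A T : Type*) [Fintype A] [Nonempty A] (l : GS A T → ℕ∞) :
    tau (mstar l) = minim (⋃ n : ℕ, wpow (tau l) n) := by
  ext ⟨s, n⟩
  refine (iInf_eq_natCast_iff_isLeast _ n).trans ?_
  simp only [minim, ← tau_mpow, Set.mem_iUnion]
  rfl
end

section
/- If X and Y are unambiguous sets of weighted guarded strings, then X ⋓ Y is unambiguous; moreover, restricted to unambiguous sets, the unambiguous union ⋓ is idempotent (X ⋓ X = X), commutative, and associative, i.e. it is a semilattice join operation on the set of all unambiguous sets of weighted guarded strings. -/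
theorem minim_subset {A T : Type*} (X : Set (GS A T × ℕ)) : minim X ⊆ X :=
  fun _ hp => hp.1

/-- Every weight occurring in `X` is bounded below by a weight occurring in `minim X`. -/
theorem exists_mem_minim_le {A T : Type*} {X : Set (GS A T × ℕ)} {s : GS A T} {n : ℕ}
    (h : (s, n) ∈ X) : ∃ m ≤ n, (s, m) ∈ minim X := by
  have hne : {k | (s, k) ∈ X}.Nonempty := ⟨n, h⟩
  exact ⟨sInf {k | (s, k) ∈ X}, Nat.sInf_le h, Nat.sInf_mem hne, fun _ hk => Nat.sInf_le hk⟩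

theorem unamb_minim {A T : Type*} (X : Set (GS A T × ℕ)) : Unamb (minim X) :=
  fun _ _ _ hn hm => IsLeast.unique hn hm

theorem Unamb.minim_eq {A T : Type*} {X : Set (GS A T × ℕ)} (hX : Unamb X) : minim X = X :=
  (minim_subset X).antisymm fun p hp => ⟨hp, fun k hk => (hX p.1 p.2 k hp hk).le⟩

theorem uunion_comm {A T : Type*} (X Y : Set (GS A T × ℕ)) : uunion X Y = uunion Y X :=
  congrArg minim (Set.union_comm X Y)

/-- If `X ⊆ Y` and each weight in `Y` is bounded below by one in `X`, then `X` and `Y` have the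
same minimization. -/
theorem minim_eq_of_subset {A T : Type*} {X Y : Set (GS A T × ℕ)} (hXY : X ⊆ Y)
    (h : ∀ s n, (s, n) ∈ Y → ∃ m ≤ n, (s, m) ∈ X) : minim X = minim Y := by
  ext ⟨s, n⟩
  constructor
  · rintro ⟨hn, hlb⟩
    refine ⟨hXY hn, fun k hk => ?_⟩
    obtain ⟨m, hmk, hm⟩ := h s k hk
    exact (hlb hm).trans hmk
  · rintro ⟨hn, hlb⟩
    obtain ⟨m, hmn, hm⟩ := h s n hn
    obtain rfl : m = n := hmn.antisymm (hlb (hXY hm))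
    exact ⟨hm, fun k hk => hlb (hXY hk)⟩

theorem uunion_minim_left {A T : Type*} (X Y : Set (GS A T × ℕ)) :
    uunion (minim X) Y = uunion X Y := by
  refine minim_eq_of_subset (Set.union_subset_union_left Y (minim_subset X)) ?_
  rintro s n (hn | hn)
  · obtain ⟨m, hmn, hm⟩ := exists_mem_minim_le hn
    exact ⟨m, hmn, Or.inl hm⟩
  · exact ⟨n, le_rfl, Or.inr hn⟩

theorem uunion_assoc {A T : Type*} (X Y Z : Set (GS A T × ℕ)) :
    uunion (uunion X Y) Z = uunion X (uunion Y Z) := by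
  rw [uunion_comm X (uunion Y Z)]
  calc uunion (minim (X ∪ Y)) Z = minim (X ∪ Y ∪ Z) := uunion_minim_left (X ∪ Y) Z
    _ = minim (Y ∪ Z ∪ X) := by rw [Set.union_assoc, Set.union_comm]
    _ = uunion (minim (Y ∪ Z)) X := (uunion_minim_left (Y ∪ Z) X).symm

/-- Unambiguous union of unambiguous sets is unambiguous, and restricted to
unambiguous sets it is idempotent, commutative and associative, i.e. a
semilattice join operation on the unambiguous sets of weighted guarded
strings. -/
theorem stmt_17 (A T : Type*) [Fintype A] [Nonempty A]
    (X Y Z : Set (GS A T × ℕ)) (hX : Unamb X) (hY : Unamb Y) (hZ : Unamb Z) :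
    Unamb (uunion X Y) ∧
    uunion X X = X ∧
    uunion X Y = uunion Y X ∧
    uunion (uunion X Y) Z = uunion X (uunion Y Z) :=
  ⟨unamb_minim (X ∪ Y), (congrArg minim (Set.union_self X)).trans hX.minim_eq,
    uunion_comm X Y, uunion_assoc X Y Z⟩
end
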